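/- Let λ, λ' : ℝ → ℍ be geodesics in the hyperbolic plane with disjoint images. Let K ≥ 1 and let f : ℍ → ℍ be a K-Lipschitz map such that: (i) there is a geodesic μ : ℝ → ℍ with f(λ(t)) = μ(K·t) for all t (so f maps λ to a geodesic, stretching distances along λ by the factor K); and (ii) there is a geodesic μ' : ℝ → ℍ whose image equals the image of f∘λ'. Assume the images of μ and μ' are disjoint and that there exist q in the image of μ and q' in the image of μ' realizing the distance between the two geodesics: dist(q,q') ≤ dist(p,p') for all p in the image of μ and p' in the image of μ' (q and q' are the endpoints of the common perpendicular). Then for any x, y on λ with dist(f(x),q) ≥ dist(f(y),q), and any x' on λ', one has sinh(dist(q,q')) · cosh(K·dist(x,y)/2) ≤ sinh(K·dist(x,x')). -/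

import Mathlib

open UpperHalfPlane

/-- The symmetric bilinear form of signature `(1, 2)` on `ℝ³` polarizing `u * w - v ^ 2`. -/
noncomputable def lorentzForm (a b : ℝ × ℝ × ℝ) : ℝ :=
  (a.1 * b.2.2 + a.2.2 * b.1) / 2 - a.2.1 * b.2.1

/-- The hyperboloid model: the embedding of the upper half-plane in `ℝ³` for which
`lorentzForm` computes `cosh` of the distance. -/
noncomputable def toHyperboloid (z : ℍ) : ℝ × ℝ × ℝ :=
  ((z.re ^ 2 + z.im ^ 2) / z.im, z.re / z.im, 1 / z.im)

theorem lorentzForm_comm (a b : ℝ × ℝ × ℝ) : lorentzForm a b = lorentzForm b a := by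
  simp only [lorentzForm]; ring

theorem lorentzForm_add_left (a b c : ℝ × ℝ × ℝ) :
    lorentzForm (a + b) c = lorentzForm a c + lorentzForm b c := by
  simp only [lorentzForm, Prod.fst_add, Prod.snd_add]; ring

theorem lorentzForm_smul_left (r : ℝ) (a b : ℝ × ℝ × ℝ) :
    lorentzForm (r • a) b = r * lorentzForm a b := by
  simp only [lorentzForm, Prod.smul_fst, Prod.smul_snd, smul_eq_mul]; ring

theorem lorentzForm_add_right (a b c : ℝ × ℝ × ℝ) :
    lorentzForm a (b + c) = lorentzForm a b + lorentzForm a c := by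
  simp only [lorentzForm, Prod.fst_add, Prod.snd_add]; ring

theorem lorentzForm_smul_right (r : ℝ) (a b : ℝ × ℝ × ℝ) :
    lorentzForm a (r • b) = r * lorentzForm a b := by
  simp only [lorentzForm, Prod.smul_fst, Prod.smul_snd, smul_eq_mul]; ring

theorem lorentzForm_toHyperboloid (z w : ℍ) :
    lorentzForm (toHyperboloid z) (toHyperboloid w) = Real.cosh (dist z w) := by
  have hz := z.im_pos.ne'
  have hw := w.im_pos.ne'
  rw [cosh_dist']
  simp only [lorentzForm, toHyperboloid]
  field_simp
  ring

theorem lorentzForm_toHyperboloid_self (z : ℍ) :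
    lorentzForm (toHyperboloid z) (toHyperboloid z) = 1 := by
  simp [lorentzForm_toHyperboloid]

theorem lorentzForm_self_of_orthogonal {z : ℍ} {a : ℝ × ℝ × ℝ}
    (h : lorentzForm (toHyperboloid z) a = 0) :
    lorentzForm a a = -(z.im * a.2.2) ^ 2 - (a.2.1 - z.re * a.2.2) ^ 2 := by
  have hz := z.im_pos.ne'
  have h' : a.1 = 2 * z.re * a.2.1 - (z.re ^ 2 + z.im ^ 2) * a.2.2 := by
    simp only [lorentzForm, toHyperboloid] at h
    field_simp at h
    linarith
  simp only [lorentzForm, h']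
  ring

theorem eq_zero_of_orthogonal_of_isotropic {z : ℍ} {a : ℝ × ℝ × ℝ}
    (h : lorentzForm (toHyperboloid z) a = 0) (ha : lorentzForm a a = 0) : a = 0 := by
  have hs := lorentzForm_self_of_orthogonal h
  have h₁ : (z.im * a.2.2) ^ 2 = 0 := by
    nlinarith [sq_nonneg (z.im * a.2.2), sq_nonneg (a.2.1 - z.re * a.2.2)]
  have h₂ : (a.2.1 - z.re * a.2.2) ^ 2 = 0 := by linarith
  have hw : a.2.2 = 0 := by simpa [z.im_pos.ne'] using h₁
  have hv : a.2.1 = 0 := by simpa [hw] using h₂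
  have hu : a.1 = 0 := by
    simpa [lorentzForm, toHyperboloid, hw, hv, z.im_pos.ne'] using h
  exact Prod.ext hu (Prod.ext hv hw)

theorem sq_lorentzForm_le_one_of_orthogonal {z : ℍ} {a b : ℝ × ℝ × ℝ}
    (ha : lorentzForm (toHyperboloid z) a = 0) (hb : lorentzForm (toHyperboloid z) b = 0)
    (haa : lorentzForm a a = -1) (hbb : lorentzForm b b = -1) :
    lorentzForm a b ^ 2 ≤ 1 := by
  have key : ∀ r : ℝ, lorentzForm (a + r • b) (a + r • b) ≤ 0 := fun r ↦ by
    have h : lorentzForm (toHyperboloid z) (a + r • b) = 0 := by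
      simp [lorentzForm_add_right, lorentzForm_smul_right, ha, hb]
    rw [lorentzForm_self_of_orthogonal h]
    nlinarith [sq_nonneg (z.im * (a + r • b).2.2),
      sq_nonneg ((a + r • b).2.1 - z.re * (a + r • b).2.2)]
  have h := key (lorentzForm a b)
  simp only [lorentzForm_add_left, lorentzForm_add_right, lorentzForm_smul_left,
    lorentzForm_smul_right, haa, hbb, lorentzForm_comm b a] at h
  nlinarith

/-- In the hyperboloid model a geodesic is `t ↦ cosh t • Q + sinh t • V` for a unit
tangent vector `V` at its base point `Q`. -/
theorem Isometry.exists_toHyperboloid_eq {γ : ℝ → ℍ} (hγ : Isometry γ) (s : ℝ) :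
    ∃ V : ℝ × ℝ × ℝ, lorentzForm (toHyperboloid (γ s)) V = 0 ∧ lorentzForm V V = -1 ∧
      ∀ t, toHyperboloid (γ (s + t)) =
        Real.cosh t • toHyperboloid (γ s) + Real.sinh t • V := by
  have hform : ∀ a b, lorentzForm (toHyperboloid (γ a)) (toHyperboloid (γ b)) =
      Real.cosh (a - b) := fun a b ↦ by
    rw [lorentzForm_toHyperboloid, hγ.dist_eq, Real.dist_eq, Real.cosh_abs]
  have hsinh : Real.sinh 1 ≠ 0 := by simp
  set c := Real.cosh 1
  set σ := Real.sinh 1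
  have hcs : c ^ 2 = σ ^ 2 + 1 := Real.cosh_sq 1
  set V : ℝ × ℝ × ℝ := σ⁻¹ • (toHyperboloid (γ (s + 1)) + (-c) • toHyperboloid (γ s))
  have h01 : lorentzForm (toHyperboloid (γ s)) (toHyperboloid (γ (s + 1))) = c := by
    rw [hform, ← Real.cosh_neg]; ring_nf; rfl
  have hQV : lorentzForm (toHyperboloid (γ s)) V = 0 := by
    simp only [V, lorentzForm_add_right, lorentzForm_smul_right, h01,
      lorentzForm_toHyperboloid_self]
    ring
  have hVV : lorentzForm V V = -1 := by
    simp only [V, lorentzForm_add_right, lorentzForm_smul_right, lorentzForm_add_left,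
      lorentzForm_smul_left, h01, lorentzForm_toHyperboloid_self,
      lorentzForm_comm (toHyperboloid (γ (s + 1))) (toHyperboloid (γ s))]
    field_simp
    linarith
  refine ⟨V, hQV, hVV, fun t ↦ ?_⟩
  have h0t : lorentzForm (toHyperboloid (γ s)) (toHyperboloid (γ (s + t))) = Real.cosh t := by
    rw [hform, ← Real.cosh_neg]; ring_nf
  have h1t : lorentzForm (toHyperboloid (γ (s + 1))) (toHyperboloid (γ (s + t))) =
      c * Real.cosh t - σ * Real.sinh t := by
    rw [hform, show s + 1 - (s + t) = 1 - t by ring, Real.cosh_sub]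
  have hVt : lorentzForm V (toHyperboloid (γ (s + t))) = -Real.sinh t := by
    simp only [V, lorentzForm_add_left, lorentzForm_smul_left, h0t, h1t]
    field_simp
    ring
  have hW := eq_zero_of_orthogonal_of_isotropic (z := γ s)
    (a := toHyperboloid (γ (s + t)) +
      ((-Real.cosh t) • toHyperboloid (γ s) + (-Real.sinh t) • V))
    (by
      simp only [lorentzForm_add_right, lorentzForm_smul_right, hQV, h0t,
        lorentzForm_toHyperboloid_self]
      ring)
    (by
      simp only [lorentzForm_add_right, lorentzForm_smul_right, lorentzForm_add_left,
        lorentzForm_smul_left, hQV, hVV, h0t, hVt, lorentzForm_toHyperboloid_self,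
        lorentzForm_comm V (toHyperboloid (γ s)),
        lorentzForm_comm (toHyperboloid (γ (s + t)))]
      linear_combination -(Real.cosh_sq t))
  rw [_root_.neg_smul, _root_.neg_smul, ← neg_add, ← sub_eq_add_neg, sub_eq_zero] at hW
  exact hW

theorem eq_zero_of_forall_le_cosh_add_sinh {A B : ℝ}
    (h : ∀ t, A ≤ A * Real.cosh t + B * Real.sinh t) : B = 0 := by
  have hd : HasDerivAt (fun t ↦ A * Real.cosh t + B * Real.sinh t)
      (A * Real.sinh 0 + B * Real.cosh 0) 0 :=
    ((Real.hasDerivAt_cosh 0).const_mul A).add ((Real.hasDerivAt_sinh 0).const_mul B)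
  have hmin : IsLocalMin (fun t ↦ A * Real.cosh t + B * Real.sinh t) 0 :=
    Filter.Eventually.of_forall fun t ↦ by simpa using h t
  simpa using hmin.hasDerivAt_eq_zero hd

/-- A tangent vector of a geodesic at the point nearest to `z` is orthogonal to `z`. -/
theorem lorentzForm_eq_zero_of_forall_dist_le {γ : ℝ → ℍ} {s : ℝ} {V : ℝ × ℝ × ℝ} {z : ℍ}
    (hV : ∀ t, toHyperboloid (γ (s + t)) =
      Real.cosh t • toHyperboloid (γ s) + Real.sinh t • V)
    (hmin : ∀ t, dist (γ s) z ≤ dist (γ t) z) : lorentzForm V (toHyperboloid z) = 0 := by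
  refine eq_zero_of_forall_le_cosh_add_sinh (A := Real.cosh (dist (γ s) z)) fun t ↦ ?_
  have h : Real.cosh (dist (γ s) z) ≤ Real.cosh (dist (γ (s + t)) z) := by
    rw [Real.cosh_le_cosh, abs_of_nonneg dist_nonneg, abs_of_nonneg dist_nonneg]
    exact hmin _
  rw [← lorentzForm_toHyperboloid (γ (s + t)), hV, lorentzForm_add_left,
    lorentzForm_smul_left, lorentzForm_smul_left, lorentzForm_toHyperboloid] at h
  linarith

/-- The distance from a point `γ (s + t)` to a geodesic `δ`, when `γ s` and `δ s'` are the feet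
of the common perpendicular of `γ` and `δ`. -/
theorem sinh_dist_mul_cosh_le_sinh_dist {γ δ : ℝ → ℍ} (hγ : Isometry γ) (hδ : Isometry δ)
    {s s' : ℝ} (hmin : ∀ t t', dist (γ s) (δ s') ≤ dist (γ t) (δ t')) (t t' : ℝ) :
    Real.sinh (dist (γ s) (δ s')) * Real.cosh t ≤
      Real.sinh (dist (γ (s + t)) (δ (s' + t'))) := by
  obtain ⟨V, hQV, hVV, hV⟩ := hγ.exists_toHyperboloid_eq s
  obtain ⟨W, hRW, hWW, hW⟩ := hδ.exists_toHyperboloid_eq s'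
  have hVR := lorentzForm_eq_zero_of_forall_dist_le hV (fun t ↦ hmin t s')
  have hQW : lorentzForm W (toHyperboloid (γ s)) = 0 :=
    lorentzForm_eq_zero_of_forall_dist_le hW
      (fun t ↦ by simpa only [dist_comm] using hmin s t)
  rw [lorentzForm_comm] at hQW
  have hVW := sq_lorentzForm_le_one_of_orthogonal hQV hQW hVV hWW
  have hcosh : Real.cosh (dist (γ (s + t)) (δ (s' + t'))) =
      Real.cosh (dist (γ s) (δ s')) * Real.cosh t * Real.cosh t' +
        lorentzForm V W * Real.sinh t * Real.sinh t' := by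
    rw [← lorentzForm_toHyperboloid, hV, hW]
    simp only [lorentzForm_add_left, lorentzForm_add_right, lorentzForm_smul_left,
      lorentzForm_smul_right, lorentzForm_toHyperboloid, hVR, hQW]
    ring
  refine abs_le_of_sq_le_sq' ?_ (Real.sinh_nonneg_iff.2 dist_nonneg) |>.2
  rw [mul_pow, Real.sinh_sq, Real.sinh_sq, hcosh]
  set A := Real.cosh (dist (γ s) (δ s')) * Real.cosh t with hA
  set B := lorentzForm V W * Real.sinh t with hB
  have hB' : B ^ 2 ≤ Real.sinh t ^ 2 := by
    rw [hB, mul_pow]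
    exact mul_le_of_le_one_left (sq_nonneg _) hVW
  have hexpand : (A * Real.cosh t' + B * Real.sinh t') ^ 2 =
      A ^ 2 - B ^ 2 + (A * Real.sinh t' + B * Real.cosh t') ^ 2 := by
    linear_combination (A ^ 2 - B ^ 2) * Real.cosh_sq t'
  have hA' : (Real.cosh (dist (γ s) (δ s')) ^ 2 - 1) * Real.cosh t ^ 2 =
      A ^ 2 - Real.sinh t ^ 2 - 1 := by
    rw [hA]
    linear_combination -(Real.cosh_sq t)
  rw [hexpand, hA']
  linarith [sq_nonneg (A * Real.sinh t' + B * Real.cosh t')]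

/-- Let `λ, λ'` be disjoint geodesics in the hyperbolic plane and
`f` a `K`-Lipschitz map sending `λ` to a geodesic `μ` stretched by the factor
`K` and `λ'` onto a geodesic `μ'`, with `μ, μ'` disjoint and `q, q'` the feet
of their common perpendicular.  Then for points `x, y` on `λ` with
`dist(f x, q) ≥ dist(f y, q)` and any `x'` on `λ'`,
`sinh(dist(q,q')) · cosh(K · dist(x,y)/2) ≤ sinh(K · dist(x,x'))`. -/
theorem stmt_3 (lam lam' : ℝ → UpperHalfPlane)
    (hlam : Isometry lam) (hlam' : Isometry lam')
    (hdisj : Disjoint (Set.range lam) (Set.range lam'))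
    (K : ℝ) (hK : 1 ≤ K)
    (f : UpperHalfPlane → UpperHalfPlane)
    (hf : ∀ x y : UpperHalfPlane, dist (f x) (f y) ≤ K * dist x y)
    (μ μ' : ℝ → UpperHalfPlane) (hμ : Isometry μ) (hμ' : Isometry μ')
    (hfLam : ∀ t : ℝ, f (lam t) = μ (K * t))
    (hfLam' : Set.range μ' = Set.range (f ∘ lam'))
    (hdisj' : Disjoint (Set.range μ) (Set.range μ'))
    (q q' : UpperHalfPlane) (hq : q ∈ Set.range μ) (hq' : q' ∈ Set.range μ')
    (hperp : ∀ p ∈ Set.range μ, ∀ p' ∈ Set.range μ', dist q q' ≤ dist p p')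
    (x y : ℝ) (hxy : dist (f (lam y)) q ≤ dist (f (lam x)) q)
    (x' : ℝ) :
    Real.sinh (dist q q') * Real.cosh (K * dist (lam x) (lam y) / 2) ≤
      Real.sinh (K * dist (lam x) (lam' x')) := by
  obtain ⟨s, rfl⟩ := hq
  obtain ⟨s', rfl⟩ := hq'
  obtain ⟨r', hr'⟩ : f (lam' x') ∈ Set.range μ' := hfLam' ▸ ⟨x', rfl⟩
  have key := sinh_dist_mul_cosh_le_sinh_dist hμ hμ'
    (fun t t' ↦ hperp _ ⟨t, rfl⟩ _ ⟨t', rfl⟩) (K * x - s) (r' - s')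
  rw [add_sub_cancel, add_sub_cancel, hr', ← hfLam] at key
  have hcosh : Real.cosh (K * dist (lam x) (lam y) / 2) ≤ Real.cosh (K * x - s) := by
    rw [hfLam, hfLam, hμ.dist_eq, hμ.dist_eq, Real.dist_eq, Real.dist_eq] at hxy
    have hlen : K * dist (lam x) (lam y) = |K * x - K * y| := by
      rw [hlam.dist_eq, Real.dist_eq, ← mul_sub, abs_mul, abs_of_nonneg (by linarith : 0 ≤ K)]
    rw [Real.cosh_le_cosh, hlen, abs_of_nonneg (by positivity)]
    have htri := abs_sub_le (K * x) s (K * y)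
    rw [abs_sub_comm s] at htri
    linarith
  calc _ ≤ Real.sinh (dist (μ s) (μ' s')) * Real.cosh (K * x - s) :=
        mul_le_mul_of_nonneg_left hcosh (Real.sinh_nonneg_iff.2 dist_nonneg)
    _ ≤ _ := key
    _ ≤ _ := Real.sinh_le_sinh.2 (hf _ _)
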